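/- Let X ∈ ℝ^{n×d} have rank d and let H = X(X^T X)^{−1} X^T. There exists a real constant c depending only on X (and n, d) such that for every y ∈ [−1,1]^n with y^T H y < n, sup_{μ ∈ ℝ^d, Σ ≻ 0} log L(μ, Σ; X, y) = −(n/2) log(1 − y^T H y / n) + c. Consequently, if y^T H y < n for all y ∈ {±1}^n, then a vector ŷ ∈ {±1}^n maximizes y ↦ sup_{μ, Σ ≻ 0} log L(μ, Σ; X, y) over {±1}^n if and only if it maximizes the Max-Cut objective y ↦ y^T H y over {±1}^n. -/

import Mathlib

open Real Matrix

noncomputable section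

/-- Density of the `d`-dimensional Gaussian distribution `N(μ, S)` at `x`. -/
def gaussDensity {d : ℕ} (μ : Fin d → ℝ) (S : Matrix (Fin d) (Fin d) ℝ) (x : Fin d → ℝ) : ℝ :=
  (2 * π) ^ (-(d : ℝ) / 2) * S.det ^ (-(1 : ℝ) / 2) *
    Real.exp (-(1 / 2) * ((x - μ) ⬝ᵥ (S⁻¹ *ᵥ (x - μ))))

/-- The complete-data likelihood `L(μ, Σ; X, y)`. -/
def likelihood {n d : ℕ} (X : Fin n → Fin d → ℝ) (y : Fin n → ℝ)
    (μ : Fin d → ℝ) (S : Matrix (Fin d) (Fin d) ℝ) : ℝ :=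
  ∏ i, ((1 / 2 * gaussDensity μ S (X i)) ^ ((1 + y i) / 2) *
        (1 / 2 * gaussDensity (-μ) S (X i)) ^ ((1 - y i) / 2))

/-- The matrix `H = X (XᵀX)⁻¹ Xᵀ` (the orthogonal projection onto the column space of `X`
when `X` has rank `d`). -/
def Hmat {n d : ℕ} (X : Fin n → Fin d → ℝ) : Matrix (Fin n) (Fin n) ℝ :=
  Matrix.of X * ((Matrix.of X)ᵀ * Matrix.of X)⁻¹ * (Matrix.of X)ᵀ

/-- `v` is a vector of signs ±1. -/
def isSign {m : ℕ} (v : Fin m → ℝ) : Prop := ∀ i, v i = 1 ∨ v i = -1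

theorem Matrix.PosDef.log_det_le_trace_sub_card {d : ℕ} {M : Matrix (Fin d) (Fin d) ℝ}
    (hM : M.PosDef) : Real.log M.det ≤ M.trace - d := by
  rw [hM.isHermitian.det_eq_prod_eigenvalues, hM.isHermitian.trace_eq_sum_eigenvalues]
  simp only [RCLike.ofReal_real_eq_id, id_eq]
  rw [Real.log_prod (fun i _ => (hM.eigenvalues_pos i).ne')]
  calc ∑ i, Real.log (hM.isHermitian.eigenvalues i)
      ≤ ∑ i, (hM.isHermitian.eigenvalues i - 1) :=
        Finset.sum_le_sum fun i _ => Real.log_le_sub_one_of_pos (hM.eigenvalues_pos i)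
    _ = _ := by simp [Finset.sum_sub_distrib]

open scoped MatrixOrder in
theorem Matrix.PosDef.log_det_mul_le_trace_sub_card {d : ℕ} {P C : Matrix (Fin d) (Fin d) ℝ}
    (hP : P.PosDef) (hC : C.PosDef) : Real.log (P.det * C.det) ≤ (P * C).trace - d := by
  obtain ⟨T, rfl⟩ := CStarAlgebra.nonneg_iff_eq_star_mul_self.mp hP.posSemidef.nonneg
  have hT : IsUnit T := by
    rw [Matrix.isUnit_iff_isUnit_det]
    have := hP.det_pos
    rw [Matrix.det_mul] at this
    exact isUnit_iff_ne_zero.mpr (right_ne_zero_of_mul this.ne')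
  have h := ((Matrix.IsUnit.posDef_star_right_conjugate_iff hT).mpr
    hC).log_det_le_trace_sub_card
  have e1 : (T * C * star T).det = (star T * T).det * C.det := by
    simp only [Matrix.det_mul]; ring
  rwa [e1, Matrix.trace_mul_comm, ← Matrix.mul_assoc] at h

theorem Matrix.PosDef.sub_vecMulVec {d : ℕ} {A : Matrix (Fin d) (Fin d) ℝ} (hA : A.PosDef)
    {v : Fin d → ℝ} {r : ℝ} (hr : 0 < r) (hv : v ⬝ᵥ (A⁻¹ *ᵥ v) < r) :
    (A - r⁻¹ • vecMulVec v v).PosDef := by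
  have hsymm : Aᵀ = A :=
    (Matrix.conjTranspose_eq_transpose_of_trivial A).symm.trans hA.isHermitian
  refine .of_dotProduct_mulVec_pos ?_ fun u hu => ?_
  · rw [Matrix.IsHermitian, Matrix.conjTranspose_eq_transpose_of_trivial]
    simp [hsymm, Matrix.transpose_vecMulVec]
  have hAw : A *ᵥ (A⁻¹ *ᵥ v) = v := by
    rw [Matrix.mulVec_mulVec, Matrix.mul_nonsing_inv _ hA.det_pos.ne'.isUnit, Matrix.one_mulVec]
  have hpos : 0 < u ⬝ᵥ (A *ᵥ u) := by simpa using hA.dotProduct_mulVec_pos hu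
  set w := A⁻¹ *ᵥ v
  have hwu : w ⬝ᵥ (A *ᵥ u) = v ⬝ᵥ u := by
    rw [Matrix.dotProduct_mulVec, ← Matrix.mulVec_transpose, hsymm, hAw]
  have hnn := hA.posSemidef.dotProduct_mulVec_nonneg (u + (-(v ⬝ᵥ u) / r) • w)
  simp only [star_trivial, Matrix.mulVec_add, Matrix.mulVec_smul, hAw, add_dotProduct,
    dotProduct_add, smul_dotProduct, dotProduct_smul, smul_eq_mul, hwu,
    dotProduct_comm w v, dotProduct_comm u v] at hnn
  have hgoal : star u ⬝ᵥ ((A - r⁻¹ • vecMulVec v v) *ᵥ u)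
      = u ⬝ᵥ (A *ᵥ u) - (v ⬝ᵥ u) ^ 2 / r := by
    simp only [star_trivial, Matrix.sub_mulVec, dotProduct_sub, Matrix.smul_mulVec,
      dotProduct_smul, Matrix.vecMulVec_mulVec, smul_eq_mul, op_smul_eq_smul, dotProduct_comm u v]
    field_simp
  rw [hgoal]
  rcases eq_or_ne (v ⬝ᵥ u) 0 with h0 | h0
  · simpa [h0] using hpos
  · have h1 : (v ⬝ᵥ u) ^ 2 * (v ⬝ᵥ w) / r ^ 2 < (v ⬝ᵥ u) ^ 2 / r := by
      rw [div_lt_div_iff₀ (by positivity) hr]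
      have : 0 < (v ⬝ᵥ u) ^ 2 * r := by positivity
      nlinarith
    have h2 : u ⬝ᵥ (A *ᵥ u) - 2 * ((v ⬝ᵥ u) ^ 2 / r) + (v ⬝ᵥ u) ^ 2 * (v ⬝ᵥ w) / r ^ 2 ≥ 0 := by
      refine hnn.trans_eq ?_
      field_simp
      ring
    linarith

theorem Matrix.det_sub_smul_vecMulVec {d : ℕ} {A : Matrix (Fin d) (Fin d) ℝ}
    (hA : IsUnit A.det) (v : Fin d → ℝ) (r : ℝ) :
    (A - r⁻¹ • vecMulVec v v).det = A.det * (1 - v ⬝ᵥ (A⁻¹ *ᵥ v) / r) := by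
  have h := Matrix.det_add_replicateCol_mul_replicateRow (ι := Unit) hA (-r⁻¹ • v) v
  rw [← Matrix.vecMulVec_eq Unit, Matrix.smul_vecMulVec, neg_smul, ← sub_eq_add_neg] at h
  rw [h, Matrix.det_unique (n := Unit), Matrix.add_apply, Matrix.one_apply_eq, Matrix.mul_assoc,
    Matrix.mul_apply]
  congr 1
  simp [← Matrix.replicateCol_mulVec, Matrix.mulVec_neg, Matrix.mulVec_smul,
    Finset.mul_sum, dotProduct, div_eq_inv_mul, sub_eq_add_neg, mul_left_comm]

theorem Matrix.posDef_transpose_mul_self_of_rank_eq {n d : ℕ} {M : Matrix (Fin n) (Fin d) ℝ}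
    (h : M.rank = d) : (Mᵀ * M).PosDef := by
  have hinj : Function.Injective M.mulVec := by
    have hker : LinearMap.ker M.mulVecLin = ⊥ := by
      have := LinearMap.finrank_range_add_finrank_ker M.mulVecLin
      rw [← Matrix.rank, h] at this
      simpa using this
    exact LinearMap.ker_eq_bot.mp hker
  simpa using Matrix.PosDef.conjTranspose_mul_self M hinj

theorem gaussDensity_pos_and_log_eq {d : ℕ} (μ x : Fin d → ℝ) {S : Matrix (Fin d) (Fin d) ℝ}
    (hS : S.PosDef) :
    0 < gaussDensity μ S x ∧
    Real.log (gaussDensity μ S x) = -(d : ℝ) / 2 * Real.log (2 * π) - 1 / 2 * Real.log S.det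
      - 1 / 2 * ((x - μ) ⬝ᵥ (S⁻¹ *ᵥ (x - μ))) := by
  have hdet := hS.det_pos
  have h2 : 0 < 2 * π := by positivity
  have := Real.rpow_pos_of_pos h2 (-(d : ℝ) / 2)
  have := Real.rpow_pos_of_pos hdet (-(1 : ℝ) / 2)
  refine ⟨by unfold gaussDensity; positivity, ?_⟩
  rw [gaussDensity, Real.log_mul (by positivity) (by positivity),
    Real.log_mul (by positivity) (by positivity), Real.log_exp, Real.log_rpow h2,
    Real.log_rpow hdet]
  ring

theorem log_likelihood_eq {n d : ℕ} (hn : 1 ≤ n) (X : Fin n → Fin d → ℝ) (y : Fin n → ℝ)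
    (μ : Fin d → ℝ) {S : Matrix (Fin d) (Fin d) ℝ} (hS : S.PosDef) :
    Real.log (likelihood X y μ S) =
      n * (Real.log (1 / 2) - (d : ℝ) / 2 * Real.log (2 * π) - 1 / 2 * Real.log S.det)
      - 1 / 2 * ((S⁻¹ * ((Matrix.of X)ᵀ * Matrix.of X - (n : ℝ)⁻¹ •
          vecMulVec ((Matrix.of X)ᵀ *ᵥ y) ((Matrix.of X)ᵀ *ᵥ y))).trace
        + n * ((μ - (n : ℝ)⁻¹ • ((Matrix.of X)ᵀ *ᵥ y)) ⬝ᵥ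
          (S⁻¹ *ᵥ (μ - (n : ℝ)⁻¹ • ((Matrix.of X)ᵀ *ᵥ y))))) := by
  have hn0 : (n : ℝ) ≠ 0 := by positivity
  have hsymm : (S⁻¹)ᵀ = S⁻¹ :=
    (Matrix.conjTranspose_eq_transpose_of_trivial _).symm.trans hS.inv.isHermitian
  have hcomm (a b : Fin d → ℝ) : a ⬝ᵥ (S⁻¹ *ᵥ b) = b ⬝ᵥ (S⁻¹ *ᵥ a) := by
    rw [Matrix.dotProduct_mulVec, ← Matrix.mulVec_transpose, hsymm, dotProduct_comm]
  have hhalf : (0 : ℝ) < 1 / 2 := by norm_num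
  have hpos (m : Fin d → ℝ) (i : Fin n) : 0 < 1 / 2 * gaussDensity m S (X i) :=
    mul_pos hhalf (gaussDensity_pos_and_log_eq m (X i) hS).1
  have hlog (m : Fin d → ℝ) (i : Fin n) : Real.log (1 / 2 * gaussDensity m S (X i)) =
      Real.log (1 / 2) + (-(d : ℝ) / 2 * Real.log (2 * π) - 1 / 2 * Real.log S.det
      - 1 / 2 * ((X i - m) ⬝ᵥ (S⁻¹ *ᵥ (X i - m)))) := by
    rw [Real.log_mul hhalf.ne' (gaussDensity_pos_and_log_eq m (X i) hS).1.ne',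
      (gaussDensity_pos_and_log_eq m (X i) hS).2]
  set P := S⁻¹
  set v := (Matrix.of X)ᵀ *ᵥ y with hv
  have htrace : ∑ i, X i ⬝ᵥ (P *ᵥ X i) = (P * ((Matrix.of X)ᵀ * Matrix.of X)).trace := by
    rw [← Matrix.mul_assoc, Matrix.trace_mul_comm, Matrix.trace]
    refine Finset.sum_congr rfl fun i _ => ?_
    rw [Matrix.diag_apply, Matrix.mul_apply, dotProduct]
    refine Finset.sum_congr rfl fun j _ => ?_
    rw [Matrix.mul_apply, Matrix.mulVec, dotProduct]
    rfl
  have hcross : ∑ i, y i * (X i ⬝ᵥ (P *ᵥ μ)) = v ⬝ᵥ (P *ᵥ μ) := by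
    rw [hv, Matrix.mulVec_transpose, ← Matrix.dotProduct_mulVec]
    rfl
  have hterm (i : Fin n) :
      Real.log ((1 / 2 * gaussDensity μ S (X i)) ^ ((1 + y i) / 2) *
        (1 / 2 * gaussDensity (-μ) S (X i)) ^ ((1 - y i) / 2)) =
      (Real.log (1 / 2) - (d : ℝ) / 2 * Real.log (2 * π) - 1 / 2 * Real.log S.det
        - 1 / 2 * (μ ⬝ᵥ (P *ᵥ μ)))
      - 1 / 2 * (X i ⬝ᵥ (P *ᵥ X i)) + y i * (X i ⬝ᵥ (P *ᵥ μ)) := by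
    rw [Real.log_mul (Real.rpow_pos_of_pos (hpos _ _) _).ne'
      (Real.rpow_pos_of_pos (hpos _ _) _).ne', Real.log_rpow (hpos _ _),
      Real.log_rpow (hpos _ _), hlog, hlog]
    simp only [sub_neg_eq_add, Matrix.mulVec_add, Matrix.mulVec_sub, dotProduct_add,
      dotProduct_sub, add_dotProduct, sub_dotProduct, hcomm μ (X i)]
    ring
  rw [likelihood, Real.log_prod fun i _ => (mul_pos (Real.rpow_pos_of_pos (hpos _ _) _)
    (Real.rpow_pos_of_pos (hpos _ _) _)).ne', Finset.sum_congr rfl fun i _ => hterm i,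
    Finset.sum_add_distrib, Finset.sum_sub_distrib, ← Finset.mul_sum, hcross, htrace]
  have hvv : (P * vecMulVec v v).trace = v ⬝ᵥ (P *ᵥ v) := by
    rw [Matrix.mul_vecMulVec, Matrix.trace_vecMulVec, dotProduct_comm]
  simp only [Matrix.mul_sub, Matrix.mul_smul, Matrix.trace_sub, Matrix.trace_smul, hvv,
    Matrix.mulVec_sub, Matrix.mulVec_smul, dotProduct_sub, sub_dotProduct, dotProduct_smul,
    smul_dotProduct, smul_eq_mul, hcomm μ v, Finset.sum_const, Finset.card_univ,
    Fintype.card_fin, nsmul_eq_mul]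
  field_simp
  ring

/-- The maximum of the log-likelihood is attained at `μ = Xᵀy / n`,
`S = (XᵀX - Xᵀy yᵀX / n) / n`. -/
theorem isGreatest_log_likelihood {n d : ℕ} (hn : 1 ≤ n) (X : Fin n → Fin d → ℝ)
    (hrank : (Matrix.of X).rank = d) (y : Fin n → ℝ) (hy : y ⬝ᵥ (Hmat X *ᵥ y) < n) :
    IsGreatest {t : ℝ | ∃ (μ : Fin d → ℝ) (S : Matrix (Fin d) (Fin d) ℝ),
          S.PosDef ∧ t = Real.log (likelihood X y μ S)}
      (-((n : ℝ) / 2) * Real.log (1 - y ⬝ᵥ (Hmat X *ᵥ y) / n) +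
        (n * (Real.log (1 / 2) - (d : ℝ) / 2 * Real.log (2 * π)
          - 1 / 2 * Real.log ((Matrix.of X)ᵀ * Matrix.of X).det
          + (d : ℝ) / 2 * Real.log n - (d : ℝ) / 2))) := by
  have hn0 : (0 : ℝ) < n := by positivity
  have hA := Matrix.posDef_transpose_mul_self_of_rank_eq hrank
  have hq : y ⬝ᵥ (Hmat X *ᵥ y) = ((Matrix.of X)ᵀ *ᵥ y) ⬝ᵥ
      (((Matrix.of X)ᵀ * Matrix.of X)⁻¹ *ᵥ ((Matrix.of X)ᵀ *ᵥ y)) := by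
    rw [Hmat, ← Matrix.mulVec_mulVec, ← Matrix.mulVec_mulVec, Matrix.dotProduct_mulVec,
      ← Matrix.mulVec_transpose]
  have hL := fun μ S hS => log_likelihood_eq hn X y μ (S := S) hS
  rw [hq] at hy ⊢
  set A := (Matrix.of X)ᵀ * Matrix.of X
  set v := (Matrix.of X)ᵀ *ᵥ y
  have hB := hA.sub_vecMulVec hn0 hy
  have hdet := Matrix.det_sub_smul_vecMulVec hA.det_pos.ne'.isUnit v n
  set B := A - (n : ℝ)⁻¹ • vecMulVec v v
  have h1q : 0 < 1 - v ⬝ᵥ (A⁻¹ *ᵥ v) / n := by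
    rw [sub_pos, div_lt_one hn0]; exact hy
  have hlogB : Real.log B.det = Real.log A.det + Real.log (1 - v ⬝ᵥ (A⁻¹ *ᵥ v) / n) := by
    rw [hdet, Real.log_mul hA.det_pos.ne' h1q.ne']
  have hC : ((n : ℝ)⁻¹ • B).PosDef := hB.smul (inv_pos.mpr hn0)
  have hlogC : Real.log ((n : ℝ)⁻¹ • B).det = Real.log B.det - d * Real.log n := by
    rw [Matrix.det_smul, Fintype.card_fin, Real.log_mul (by positivity) hB.det_pos.ne',
      Real.log_pow, Real.log_inv]
    ring
  refine ⟨⟨(n : ℝ)⁻¹ • v, (n : ℝ)⁻¹ • B, hC, ?_⟩, ?_⟩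
  · have htr : (((n : ℝ)⁻¹ • B)⁻¹ * B).trace = n * d := by
      have h1 : B = (n : ℝ) • ((n : ℝ)⁻¹ • B) := by rw [smul_inv_smul₀ hn0.ne']
      nth_rewrite 2 [h1]
      rw [Matrix.mul_smul, Matrix.nonsing_inv_mul _ hC.det_pos.ne'.isUnit]
      simp
    rw [hL _ _ hC, hlogC, hlogB, htr, sub_self, zero_dotProduct]
    ring
  · rintro t ⟨μ, S, hS, rfl⟩
    rw [hL _ _ hS]
    have hquad : 0 ≤ n * ((μ - (n : ℝ)⁻¹ • v) ⬝ᵥ (S⁻¹ *ᵥ (μ - (n : ℝ)⁻¹ • v))) :=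
      mul_nonneg hn0.le (by
        simpa only [star_trivial] using
          hS.inv.posSemidef.dotProduct_mulVec_nonneg (μ - (n : ℝ)⁻¹ • v))
    have hmain := hS.inv.log_det_mul_le_trace_sub_card hC
    rw [Real.log_mul hS.inv.det_pos.ne' hC.det_pos.ne', hlogC, hlogB, Matrix.det_nonsing_inv,
      Ring.inverse_eq_inv', Real.log_inv, Matrix.mul_smul, Matrix.trace_smul, smul_eq_mul] at hmain
    have h2 := mul_le_mul_of_nonneg_left hmain hn0.le
    rw [mul_sub (n : ℝ) ((n : ℝ)⁻¹ * _), mul_inv_cancel_left₀ hn0.ne'] at h2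
    linarith

/-- profile log-likelihood equals `-(n/2) log(1 - yᵀHy/n) + c`, and maximizing
the profile likelihood over `{±1}ⁿ` is equivalent to the Max-Cut program `max yᵀHy`. -/
theorem mle_profile_likelihood_and_maxcut {n d : ℕ} (hn : 1 ≤ n) (hd : 1 ≤ d)
    (X : Fin n → Fin d → ℝ) (hrank : (Matrix.of X).rank = d) :
    (∃ c : ℝ, ∀ y : Fin n → ℝ, (∀ i, -1 ≤ y i ∧ y i ≤ 1) → y ⬝ᵥ (Hmat X *ᵥ y) < n →
      IsLUB {t : ℝ | ∃ (μ : Fin d → ℝ) (S : Matrix (Fin d) (Fin d) ℝ),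
          S.PosDef ∧ t = Real.log (likelihood X y μ S)}
        (-((n : ℝ) / 2) * Real.log (1 - y ⬝ᵥ (Hmat X *ᵥ y) / n) + c)) ∧
    ((∀ y : Fin n → ℝ, isSign y → y ⬝ᵥ (Hmat X *ᵥ y) < n) →
      ∀ yhat : Fin n → ℝ, isSign yhat →
        ((∀ y : Fin n → ℝ, isSign y →
            sSup {t : ℝ | ∃ (μ : Fin d → ℝ) (S : Matrix (Fin d) (Fin d) ℝ),
              S.PosDef ∧ t = Real.log (likelihood X y μ S)} ≤
            sSup {t : ℝ | ∃ (μ : Fin d → ℝ) (S : Matrix (Fin d) (Fin d) ℝ),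
              S.PosDef ∧ t = Real.log (likelihood X yhat μ S)}) ↔
          (∀ y : Fin n → ℝ, isSign y → y ⬝ᵥ (Hmat X *ᵥ y) ≤ yhat ⬝ᵥ (Hmat X *ᵥ yhat)))) := by
  refine ⟨⟨_, fun y _ hy => (isGreatest_log_likelihood hn X hrank y hy).isLUB⟩,
    fun hall yhat hyhat => forall₂_congr fun y hy => ?_⟩
  have hn0 : (0 : ℝ) < n := by positivity
  have h1 {q : ℝ} (hq : q < n) : 0 < 1 - q / n := by
    rw [sub_pos, div_lt_one hn0]; exact hq
  rw [(isGreatest_log_likelihood hn X hrank y (hall y hy)).csSup_eq,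
    (isGreatest_log_likelihood hn X hrank yhat (hall yhat hyhat)).csSup_eq,
    add_le_add_iff_right, mul_le_mul_left_of_neg (by linarith),
    Real.log_le_log_iff (h1 (hall yhat hyhat)) (h1 (hall y hy)), sub_le_sub_iff_left,
    div_le_div_iff_of_pos_right hn0]
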